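/- For every n≥1 and s>0, the set G^n_s contains a subset which is open and dense in B^n_s with respect to the norm ‖·‖_s. -/

import Mathlib

noncomputable section
open Complex

/-- The ℓ¹ norm of an integer vector. -/
def norm1 {n : ℕ} (k : Fin n → ℤ) : ℕ := ∑ i, (k i).natAbs

/-- Integer vectors whose first nonzero component is positive. -/
def Zstar (n : ℕ) : Set (Fin n → ℤ) := {k | ∃ j, 0 < k j ∧ ∀ i, i < j → k i = 0}

/-- Generators of one-dimensional maximal lattices in ℤⁿ. -/
def gen (n : ℕ) : Set (Fin n → ℤ) :=
  {k | k ∈ Zstar n ∧ Finset.univ.gcd (fun i => (k i).natAbs) = 1}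

/-- Generators of size at most `K`. -/
def genK (n : ℕ) (K : ℝ) : Set (Fin n → ℤ) := {k | k ∈ gen n ∧ (norm1 k : ℝ) ≤ K}

/-- `c` is the family of Fourier coefficients of a zero-average real analytic
function in the closed unit ball of the norm `‖f‖ₛ = sup |f_k| e^{s|k|₁}`. -/
structure InBall (n : ℕ) (s : ℝ) (c : (Fin n → ℤ) → ℂ) : Prop where
  zero : c 0 = 0
  real : ∀ k, c (-k) = (starRingEnd ℂ) (c k)
  bound : ∀ k, ‖c k‖ * Real.exp (s * norm1 k) ≤ 1

/-- The Fourier cut-off `N(δ)`. -/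
def Ncut (n : ℕ) (s δ : ℝ) : ℝ :=
  2 * max 1 (1/s * Real.log (2^44 * (2*(n:ℝ) / Real.exp 1)^n / (s^n * δ)))

/-- Condition (P1+) with parameter δ. -/
def P1plus (n : ℕ) (s δ : ℝ) (c : (Fin n → ℤ) → ℂ) : Prop :=
  ∀ k ∈ gen n, Ncut n s δ ≤ (norm1 k : ℝ) →
    δ / (norm1 k : ℝ)^n * Real.exp (-(s * norm1 k)) ≤ ‖c k‖

/-- Complex extension of the Fourier projection `π_{ℤk} f` onto modes proportional to `k`. -/
def projC {n : ℕ} (c : (Fin n → ℤ) → ℂ) (k : Fin n → ℤ) (θ : ℂ) : ℂ :=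
  ∑' j : ℤ, if j = 0 then 0 else c (j • k) * Complex.exp (Complex.I * (j : ℂ) * θ)

/-- Real restriction of the Fourier projection `π_{ℤk} f`. -/
def projR {n : ℕ} (c : (Fin n → ℤ) → ℂ) (k : Fin n → ℤ) (θ : ℝ) : ℝ :=
  (projC c k (θ : ℂ)).re

/-- `F` is a `β`-Morse function on the torus `ℝ/2πℤ`. -/
def BetaMorse (β : ℝ) (F : ℝ → ℝ) : Prop :=
  (∀ θ : ℝ, β ≤ |deriv F θ| + |deriv (deriv F) θ|) ∧
  (∀ θ₁ θ₂ : ℝ, deriv F θ₁ = 0 → deriv F θ₂ = 0 →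
    (¬ ∃ m : ℤ, θ₁ - θ₂ = 2 * Real.pi * m) → β ≤ |F θ₁ - F θ₂|)

/-- `F` is a Morse function with distinct critical values on the torus `ℝ/2πℤ`. -/
def MorseWithDistinctValues (F : ℝ → ℝ) : Prop :=
  (∀ θ : ℝ, deriv F θ = 0 → deriv (deriv F) θ ≠ 0) ∧
  (∀ θ₁ θ₂ : ℝ, deriv F θ₁ = 0 → deriv F θ₂ = 0 → F θ₁ = F θ₂ →
    ∃ m : ℤ, θ₁ - θ₂ = 2 * Real.pi * m)

/-- The liminf condition (P1): `liminf |f_k| e^{s|k|₁} |k|₁ⁿ > 0` along `k ∈ 𝒢ⁿ`. -/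
def LiminfPos (n : ℕ) (s : ℝ) (c : (Fin n → ℤ) → ℂ) : Prop :=
  ∃ d : ℝ, 0 < d ∧ ∃ N : ℝ, ∀ k ∈ gen n, N ≤ (norm1 k : ℝ) →
    d ≤ ‖c k‖ * Real.exp (s * norm1 k) * (norm1 k : ℝ)^n

/-- The generic class `𝔾ⁿₛ` (in terms of Fourier coefficients). -/
def Gset (n : ℕ) (s : ℝ) : Set ((Fin n → ℤ) → ℂ) :=
  {c | InBall n s c ∧ LiminfPos n s c ∧ ∀ k ∈ gen n, MorseWithDistinctValues (projR c k)}

/-- The class `𝔾ⁿₛ(δ,β)`. -/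
def GsetDB (n : ℕ) (s δ β : ℝ) : Set ((Fin n → ℤ) → ℂ) :=
  {c | InBall n s c ∧ P1plus n s δ c ∧
    ∀ k ∈ gen n, (norm1 k : ℝ) ≤ Ncut n s δ → BetaMorse β (projR c k)}


/-- The distance induced by the norm `‖f‖ₛ = sup_k |f_k| e^{s|k|₁}`. -/
def distS (s : ℝ) {n : ℕ} (c c' : (Fin n → ℤ) → ℂ) : ℝ :=
  ⨆ k : Fin n → ℤ, ‖c k - c' k‖ * Real.exp (s * norm1 k)

/-- The trigonometric polynomial of degree two with prescribed real coefficients. -/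
def quadTrig (w : ℝ × ℝ × ℝ × ℝ) (θ : ℝ) : ℝ :=
  2 * (w.1 * Real.cos θ + w.2.1 * Real.sin θ
    + w.2.2.1 * Real.cos (2 * θ) + w.2.2.2 * Real.sin (2 * θ))

lemma deriv_quadTrig (w : ℝ × ℝ × ℝ × ℝ) :
    deriv (quadTrig w) = fun θ => 2 * (-w.1 * Real.sin θ + w.2.1 * Real.cos θ
      - 2 * w.2.2.1 * Real.sin (2 * θ) + 2 * w.2.2.2 * Real.cos (2 * θ)) := by
  funext θ
  have h2 : HasDerivAt (fun θ : ℝ => 2 * θ) 2 θ := by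
    simpa using (hasDerivAt_id θ).const_mul 2
  have h := ((((Real.hasDerivAt_cos θ).const_mul w.1).add
    ((Real.hasDerivAt_sin θ).const_mul w.2.1)).add
    ((h2.cos).const_mul w.2.2.1)).add ((h2.sin).const_mul w.2.2.2) |>.const_mul 2
  refine (HasDerivAt.deriv (f := quadTrig w) h).trans ?_
  ring

lemma deriv_deriv_quadTrig (w : ℝ × ℝ × ℝ × ℝ) :
    deriv (deriv (quadTrig w)) = fun θ => 2 * (-w.1 * Real.cos θ - w.2.1 * Real.sin θ
      - 4 * w.2.2.1 * Real.cos (2 * θ) - 4 * w.2.2.2 * Real.sin (2 * θ)) := by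
  rw [deriv_quadTrig]
  funext θ
  have h2 : HasDerivAt (fun θ : ℝ => 2 * θ) 2 θ := by
    simpa using (hasDerivAt_id θ).const_mul 2
  have h := ((((Real.hasDerivAt_sin θ).const_mul (-w.1)).add
    ((Real.hasDerivAt_cos θ).const_mul w.2.1)).sub
    ((h2.sin).const_mul (2 * w.2.2.1))).add ((h2.cos).const_mul (2 * w.2.2.2)) |>.const_mul 2
  refine (HasDerivAt.deriv h).trans ?_
  ring

lemma contDiff_quadTrig (w : ℝ × ℝ × ℝ × ℝ) {n : WithTop ℕ∞} : ContDiff ℝ n (quadTrig w) := by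
  unfold quadTrig
  fun_prop

lemma periodic_quadTrig (w : ℝ × ℝ × ℝ × ℝ) : Function.Periodic (quadTrig w) (2 * Real.pi) := by
  intro θ
  have h : 2 * (θ + 2 * Real.pi) = 2 * θ + 2 * Real.pi + 2 * Real.pi := by ring
  simp only [quadTrig, h, Real.cos_add_two_pi, Real.sin_add_two_pi]

lemma Function.Periodic.deriv_real {F : ℝ → ℝ} {T : ℝ} (hF : Function.Periodic F T) :
    Function.Periodic (deriv F) T := by
  intro x
  rw [← deriv_comp_add_const]
  congr 1
  funext y
  exact hF y

lemma exists_add_int_mul_mem_Ico (θ : ℝ) :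
    ∃ m : ℤ, θ + m * (2 * Real.pi) ∈ Set.Ico 0 (2 * Real.pi) := by
  have h := toIcoMod_mem_Ico Real.two_pi_pos 0 θ
  rw [toIcoMod, zsmul_eq_mul, zero_add] at h
  refine ⟨-toIcoDiv Real.two_pi_pos 0 θ, ?_⟩
  push_cast
  rwa [neg_mul, ← sub_eq_add_neg]

/-- Two points of a circle have either equal classes, or representatives at distance less than
the length of the circle. -/
lemma exists_representative (θ₁ θ₂ : ℝ) :
    (∃ m : ℤ, θ₁ - θ₂ = 2 * Real.pi * m) ∨
      ∃ m : ℤ, θ₂ < θ₁ + m * (2 * Real.pi) ∧ θ₁ + m * (2 * Real.pi) < θ₂ + 2 * Real.pi := by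
  obtain ⟨m, hm⟩ := exists_add_int_mul_mem_Ico (θ₁ - θ₂)
  rcases hm.1.eq_or_lt with h | h
  · left
    exact ⟨-m, by push_cast; linarith⟩
  · right
    exact ⟨m, by linarith, by linarith [hm.2]⟩

/-- The coefficients of the quadratic trigonometric polynomials `P` with given second order
coefficients for which `θ` is a degenerate critical point of `F + P`. -/
def degenerateCoeff (F : ℝ → ℝ) (p : ℝ × ℝ × ℝ) : ℝ × ℝ × ℝ × ℝ :=
  let X := deriv F p.1 / 2 - 2 * p.2.1 * Real.sin (2 * p.1) + 2 * p.2.2 * Real.cos (2 * p.1)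
  let Y := deriv (deriv F) p.1 / 2 - 4 * p.2.1 * Real.cos (2 * p.1)
    - 4 * p.2.2 * Real.sin (2 * p.1)
  (X * Real.sin p.1 + Y * Real.cos p.1, -X * Real.cos p.1 + Y * Real.sin p.1, p.2.1, p.2.2)

/-- The coefficients of the quadratic trigonometric polynomials `P` for which `m + h` and `m - h`
are critical points of `F + P` with equal values; the point `p` is `(m, h, c)`, where `c` is a
free parameter. -/
def coincidentCoeff (F : ℝ → ℝ) (p : ℝ × ℝ × ℝ) : ℝ × ℝ × ℝ × ℝ :=
  let A := deriv F (p.1 + p.2.1)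
  let B := deriv F (p.1 - p.2.1)
  let C := F (p.1 + p.2.1) - F (p.1 - p.2.1)
  let d := (-C / 4 * Real.cos p.2.1 + (A + B) / 4 * Real.sin p.2.1) / (2 * Real.sin p.2.1 ^ 3)
  let b := (-C / 4 - d * Real.sin (2 * p.2.1)) / Real.sin p.2.1
  let a := ((A - B) / 4 - 2 * p.2.2 * Real.sin (2 * p.2.1)) / Real.sin p.2.1
  (a * Real.cos p.1 - b * Real.sin p.1, a * Real.sin p.1 + b * Real.cos p.1,
    p.2.2 * Real.cos (2 * p.1) - d * Real.sin (2 * p.1),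
    p.2.2 * Real.sin (2 * p.1) + d * Real.cos (2 * p.1))

lemma contDiff_degenerateCoeff {F : ℝ → ℝ} (hF : ContDiff ℝ 3 F) :
    ContDiff ℝ 1 (degenerateCoeff F) := by
  have h1 : ContDiff ℝ 2 (deriv F) := (contDiff_succ_iff_deriv (n := 2)).1 hF |>.2.2
  have h2 : ContDiff ℝ 1 (deriv (deriv F)) := (contDiff_succ_iff_deriv (n := 1)).1 h1 |>.2.2
  have h1' : ContDiff ℝ 1 (deriv F) := h1.of_le (by norm_num)
  unfold degenerateCoeff
  fun_prop

lemma contDiffOn_coincidentCoeff {F : ℝ → ℝ} (hF : ContDiff ℝ 2 F) :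
    ContDiffOn ℝ 1 (coincidentCoeff F) {p | p.2.1 ∈ Set.Ioo 0 Real.pi} := by
  have h1 : ContDiff ℝ 1 (deriv F) := (contDiff_succ_iff_deriv (n := 1)).1 hF |>.2.2
  have h0 : ContDiff ℝ 1 F := hF.of_le (by norm_num)
  have hs : ∀ p ∈ {p : ℝ × ℝ × ℝ | p.2.1 ∈ Set.Ioo 0 Real.pi}, Real.sin p.2.1 ≠ 0 :=
    fun p hp => (Real.sin_pos_of_mem_Ioo hp).ne'
  have hs3 : ∀ p ∈ {p : ℝ × ℝ × ℝ | p.2.1 ∈ Set.Ioo 0 Real.pi}, 2 * Real.sin p.2.1 ^ 3 ≠ 0 :=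
    fun p hp => mul_ne_zero two_ne_zero (pow_ne_zero 3 (hs p hp))
  have hd : ContDiffOn ℝ 1 (fun p : ℝ × ℝ × ℝ =>
      (-(F (p.1 + p.2.1) - F (p.1 - p.2.1)) / 4 * Real.cos p.2.1 +
        (deriv F (p.1 + p.2.1) + deriv F (p.1 - p.2.1)) / 4 * Real.sin p.2.1)
        / (2 * Real.sin p.2.1 ^ 3)) {p | p.2.1 ∈ Set.Ioo 0 Real.pi} :=
    ContDiffOn.div (by fun_prop) (by fun_prop) hs3
  have hb := ContDiffOn.div (𝕜 := ℝ) (n := 1) (s := {p : ℝ × ℝ × ℝ | p.2.1 ∈ Set.Ioo 0 Real.pi})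
    (f := fun p : ℝ × ℝ × ℝ => -(F (p.1 + p.2.1) - F (p.1 - p.2.1)) / 4 - (
      (-(F (p.1 + p.2.1) - F (p.1 - p.2.1)) / 4 * Real.cos p.2.1 +
        (deriv F (p.1 + p.2.1) + deriv F (p.1 - p.2.1)) / 4 * Real.sin p.2.1)
        / (2 * Real.sin p.2.1 ^ 3)) * Real.sin (2 * p.2.1)) (g := fun p => Real.sin p.2.1)
    (ContDiffOn.sub (by fun_prop) (hd.mul (by fun_prop))) (by fun_prop) hs
  have ha := ContDiffOn.div (𝕜 := ℝ) (n := 1) (s := {p : ℝ × ℝ × ℝ | p.2.1 ∈ Set.Ioo 0 Real.pi})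
    (f := fun p : ℝ × ℝ × ℝ => (deriv F (p.1 + p.2.1) - deriv F (p.1 - p.2.1)) / 4
      - 2 * p.2.2 * Real.sin (2 * p.2.1)) (g := fun p => Real.sin p.2.1)
    (by fun_prop) (by fun_prop) hs
  refine ContDiffOn.prodMk ?_ (ContDiffOn.prodMk ?_ (ContDiffOn.prodMk ?_ ?_))
  · exact (ha.mul (by fun_prop)).sub (hb.mul (by fun_prop))
  · exact (ha.mul (by fun_prop)).add (hb.mul (by fun_prop))
  · exact ContDiffOn.sub (by fun_prop) (hd.mul (by fun_prop))
  · exact ContDiffOn.add (by fun_prop) (hd.mul (by fun_prop))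

lemma eq_degenerateCoeff {F : ℝ → ℝ} {w : ℝ × ℝ × ℝ × ℝ} {θ : ℝ}
    (h1 : deriv F θ + deriv (quadTrig w) θ = 0)
    (h2 : deriv (deriv F) θ + deriv (deriv (quadTrig w)) θ = 0) :
    degenerateCoeff F (θ, w.2.2.1, w.2.2.2) = w := by
  obtain ⟨a, b, c, d⟩ := w
  rw [deriv_quadTrig] at h1
  rw [deriv_deriv_quadTrig] at h2
  simp only at h1 h2
  have hsc := Real.sin_sq_add_cos_sq θ
  simp only [degenerateCoeff, Prod.mk.injEq, and_true]
  constructor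
  · linear_combination (Real.sin θ / 2) * h1 + (Real.cos θ / 2) * h2 + a * hsc
  · linear_combination (-Real.cos θ / 2) * h1 + (Real.sin θ / 2) * h2 + b * hsc

lemma eq_coincidentCoeff {F : ℝ → ℝ} {w : ℝ × ℝ × ℝ × ℝ} {m h : ℝ} (hh : h ∈ Set.Ioo 0 Real.pi)
    (h1 : deriv F (m + h) + deriv (quadTrig w) (m + h) = 0)
    (h2 : deriv F (m - h) + deriv (quadTrig w) (m - h) = 0)
    (h3 : F (m + h) + quadTrig w (m + h) = F (m - h) + quadTrig w (m - h)) :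
    coincidentCoeff F (m, h, w.2.2.1 * Real.cos (2 * m) + w.2.2.2 * Real.sin (2 * m)) = w := by
  obtain ⟨a, b, c, d⟩ := w
  have hs : Real.sin h ≠ 0 := (Real.sin_pos_of_mem_Ioo hh).ne'
  rw [deriv_quadTrig] at h1 h2
  simp only [quadTrig] at h1 h2 h3
  have hsc := Real.sin_sq_add_cos_sq m
  have hsc2 := Real.sin_sq_add_cos_sq (2 * m)
  have hsch := Real.sin_sq_add_cos_sq h
  simp only [mul_add, mul_sub, Real.sin_add, Real.sin_sub, Real.cos_add, Real.cos_sub]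
    at h1 h2 h3
  have hd : (-(F (m + h) - F (m - h)) / 4 * Real.cos h +
      (deriv F (m + h) + deriv F (m - h)) / 4 * Real.sin h) / (2 * Real.sin h ^ 3) =
      d * Real.cos (2 * m) - c * Real.sin (2 * m) := by
    rw [div_eq_iff (mul_ne_zero two_ne_zero (pow_ne_zero 3 hs))]
    simp only [Real.sin_two_mul h, Real.cos_two_mul h] at h1 h2 h3
    linear_combination (Real.sin h / 4) * h1 + (Real.sin h / 4) * h2 - (Real.cos h / 4) * h3
      + (d * Real.cos (2 * m) - c * Real.sin (2 * m)) * (-2 * Real.sin h) * hsch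
  have hb : (-(F (m + h) - F (m - h)) / 4 - (d * Real.cos (2 * m) - c * Real.sin (2 * m))
      * Real.sin (2 * h)) / Real.sin h = b * Real.cos m - a * Real.sin m := by
    rw [div_eq_iff hs]
    linear_combination (-1 / 4) * h3
  have ha : ((deriv F (m + h) - deriv F (m - h)) / 4 - 2 * (c * Real.cos (2 * m)
      + d * Real.sin (2 * m)) * Real.sin (2 * h)) / Real.sin h
      = a * Real.cos m + b * Real.sin m := by
    rw [div_eq_iff hs]
    linear_combination (1 / 4) * h1 - (1 / 4) * h2
  simp only [coincidentCoeff, hd, hb, ha, Prod.mk.injEq]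
  refine ⟨?_, ?_, ?_, ?_⟩
  · linear_combination a * hsc
  · linear_combination b * hsc
  · linear_combination c * hsc2
  · linear_combination d * hsc2

lemma deriv_add_quadTrig {F : ℝ → ℝ} (hF : ContDiff ℝ 3 F) (w : ℝ × ℝ × ℝ × ℝ) :
    deriv (fun θ => F θ + quadTrig w θ) = fun θ => deriv F θ + deriv (quadTrig w) θ := by
  funext θ
  exact deriv_add (hF.differentiable (by norm_num) θ)
    ((contDiff_quadTrig w (n := 1)).differentiable (by norm_num) θ)

lemma deriv_deriv_add_quadTrig {F : ℝ → ℝ} (hF : ContDiff ℝ 3 F) (w : ℝ × ℝ × ℝ × ℝ) :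
    deriv (deriv (fun θ => F θ + quadTrig w θ)) =
      fun θ => deriv (deriv F) θ + deriv (deriv (quadTrig w)) θ := by
  rw [deriv_add_quadTrig hF]
  funext θ
  have h1 : ContDiff ℝ 2 (deriv F) := (contDiff_succ_iff_deriv (n := 2)).1 hF |>.2.2
  have h2 : ContDiff ℝ 1 (deriv (quadTrig w)) :=
    (contDiff_succ_iff_deriv (n := 1)).1 (contDiff_quadTrig w) |>.2.2
  exact deriv_add (h1.differentiable (by norm_num) θ) (h2.differentiable (by norm_num) θ)

/-- A generic perturbation by a trigonometric polynomial of degree two makes a smooth function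
on the circle a Morse function with distinct critical values. -/
lemma dense_morseWithDistinctValues_add_quadTrig {F : ℝ → ℝ} (hF : ContDiff ℝ 3 F)
    (hper : Function.Periodic F (2 * Real.pi)) :
    Dense {w | MorseWithDistinctValues (fun θ => F θ + quadTrig w θ)} := by
  set S : Set (ℝ × ℝ × ℝ) := {p | p.2.1 ∈ Set.Ioo 0 Real.pi} with hS
  have hdim3 (s : Set (ℝ × ℝ × ℝ)) : dimH s ≤ 3 := by
    refine (dimH_mono (Set.subset_univ s)).trans ?_
    rw [Real.dimH_univ_eq_finrank]
    simp
  have hconv : Convex ℝ S :=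
    (convex_Ioo 0 Real.pi).linear_preimage (LinearMap.fst ℝ ℝ ℝ ∘ₗ LinearMap.snd ℝ ℝ (ℝ × ℝ))
  have hbad : dimH (degenerateCoeff F '' Set.univ ∪ coincidentCoeff F '' S) ≤ 3 := by
    rw [dimH_union]
    refine max_le ?_ ?_
    · exact ((contDiff_degenerateCoeff hF).contDiffOn.dimH_image_le convex_univ
        subset_rfl).trans (hdim3 _)
    · exact ((contDiffOn_coincidentCoeff (hF.of_le (by norm_num))).dimH_image_le hconv
        subset_rfl).trans (hdim3 _)
  have hfr : Module.finrank ℝ (ℝ × ℝ × ℝ × ℝ) = 4 := by simp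
  have hdense := dense_compl_of_dimH_lt_finrank
    (hbad.trans_lt (by rw [hfr]; norm_num) :
      dimH (degenerateCoeff F '' Set.univ ∪ coincidentCoeff F '' S) <
        Module.finrank ℝ (ℝ × ℝ × ℝ × ℝ))
  refine hdense.mono fun w hw => ?_
  simp only [Set.mem_compl_iff, Set.mem_union, not_or] at hw
  refine ⟨fun θ h1 h2 => hw.1 ?_, fun θ₁ θ₂ h1 h2 h12 => ?_⟩
  · rw [deriv_add_quadTrig hF] at h1
    rw [deriv_deriv_add_quadTrig hF] at h2
    exact ⟨_, Set.mem_univ _, eq_degenerateCoeff h1 h2⟩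
  · rcases exists_representative θ₁ θ₂ with h | ⟨j, hj1, hj2⟩
    · exact h
    · exfalso
      have hP : Function.Periodic (fun θ => F θ + quadTrig w θ) (2 * Real.pi) :=
        hper.add (periodic_quadTrig w)
      have hv := (hP.int_mul j) θ₁
      have hd := (hP.deriv_real.int_mul j) θ₁
      set φ := θ₁ + j * (2 * Real.pi)
      have hm1 : (φ + θ₂) / 2 + (φ - θ₂) / 2 = φ := by ring
      have hm2 : (φ + θ₂) / 2 - (φ - θ₂) / 2 = θ₂ := by ring
      rw [← hd, deriv_add_quadTrig hF] at h1
      rw [deriv_add_quadTrig hF] at h2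
      replace h12 := hv.trans h12
      have hmem : (φ - θ₂) / 2 ∈ Set.Ioo 0 Real.pi := ⟨by linarith, by linarith⟩
      refine hw.2 ⟨((φ + θ₂) / 2, (φ - θ₂) / 2, _), hmem,
        eq_coincidentCoeff (w := w) hmem ?_ ?_ ?_⟩
      · rw [hm1]; exact h1
      · rw [hm2]; exact h2
      · rw [hm1, hm2]; exact h12

/-- On the circle, being Morse with distinct critical values is an open condition in the
`C²` topology. -/
lemma MorseWithDistinctValues.exists_stable {F : ℝ → ℝ} (hM : MorseWithDistinctValues F)
    (hF : ContDiff ℝ 2 F) (hper : Function.Periodic F (2 * Real.pi)) :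
    ∃ ε > 0, ∀ G : ℝ → ℝ, ContDiff ℝ 2 G → Function.Periodic G (2 * Real.pi) →
      (∀ θ, |G θ - F θ| < ε) → (∀ θ, |deriv G θ - deriv F θ| < ε) →
      (∀ θ, |deriv (deriv G) θ - deriv (deriv F) θ| < ε) → MorseWithDistinctValues G := by
  have hpi := Real.two_pi_pos
  have hF1 : ContDiff ℝ 1 (deriv F) := (contDiff_succ_iff_deriv (n := 1)).1 hF |>.2.2
  have c0 : Continuous F := hF.continuous
  have c1 : Continuous (deriv F) := hF1.continuous
  have c2 : Continuous (deriv (deriv F)) := hF1.continuous_deriv le_rfl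
  have p1 := hper.deriv_real
  have p2 := p1.deriv_real
  obtain ⟨β, hβ, hβle⟩ : ∃ β > 0, ∀ θ, β ≤ |deriv F θ| + |deriv (deriv F) θ| := by
    obtain ⟨β, hβ, hle⟩ := (isCompact_Icc (a := (0 : ℝ)) (b := 2 * Real.pi)).exists_forall_le'
      (f := fun θ => |deriv F θ| + |deriv (deriv F) θ|) (by fun_prop) (a := 0) (fun θ _ => by
        by_cases h : deriv F θ = 0
        · have := abs_pos.2 (hM.1 θ h)
          positivity
        · have := abs_pos.2 h
          positivity)
    refine ⟨β, hβ, fun θ => ?_⟩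
    obtain ⟨m, hm⟩ := exists_add_int_mul_mem_Ico θ
    simpa only [p1.int_mul m θ, p2.int_mul m θ] using hle _ ⟨hm.1, hm.2.le⟩
  obtain ⟨δ, hδ, hδF⟩ := Metric.uniformContinuousOn_iff.1
    ((isCompact_Icc (a := (0 : ℝ)) (b := 2 * (2 * Real.pi))).uniformContinuousOn_of_continuous
      c2.continuousOn) (β / 2) (by positivity)
  simp only [Real.dist_eq] at hδF
  have hK : IsCompact {p : ℝ × ℝ | p ∈ Set.Icc (0 : ℝ) (2 * Real.pi) ×ˢ
      Set.Icc (0 : ℝ) (2 * (2 * Real.pi)) ∧ p.1 + δ ≤ p.2 ∧ p.2 ≤ p.1 + 2 * Real.pi - δ} := by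
    refine (isCompact_Icc.prod isCompact_Icc).inter_right ?_
    exact (isClosed_le (f := fun p : ℝ × ℝ => p.1 + δ) (g := fun p => p.2)
      (by fun_prop) (by fun_prop)).inter (isClosed_le (f := fun p : ℝ × ℝ => p.2)
        (g := fun p => p.1 + 2 * Real.pi - δ) (by fun_prop) (by fun_prop))
  obtain ⟨μ, hμ, hμle⟩ := hK.exists_forall_le'
    (f := fun p => |deriv F p.1| + |deriv F p.2| + |F p.1 - F p.2|) (by fun_prop) (a := 0) (by
      rintro ⟨x, y⟩ ⟨-, h1, h2⟩
      by_contra! h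
      have e1 : deriv F x = 0 := abs_eq_zero.1 (by
        linarith [abs_nonneg (deriv F x), abs_nonneg (deriv F y), abs_nonneg (F x - F y)])
      have e2 : deriv F y = 0 := abs_eq_zero.1 (by
        linarith [abs_nonneg (deriv F x), abs_nonneg (deriv F y), abs_nonneg (F x - F y)])
      have e3 : F x - F y = 0 := abs_eq_zero.1 (by
        linarith [abs_nonneg (deriv F x), abs_nonneg (deriv F y), abs_nonneg (F x - F y)])
      obtain ⟨m, hm⟩ := hM.2 x y e1 e2 (by linarith)
      simp only at h1 h2
      have l1 : (m : ℝ) < 0 := by nlinarith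
      have l2 : (-1 : ℝ) < m := by nlinarith
      have l1' : m < 0 := by exact_mod_cast l1
      have l2' : -1 < m := by exact_mod_cast l2
      omega)
  refine ⟨min (β / 4) (μ / 4), by positivity, fun G hG hGper h0 h1 h2 => ?_⟩
  have hεβ := min_le_left (β / 4) (μ / 4)
  have hεμ := min_le_right (β / 4) (μ / 4)
  set ε := min (β / 4) (μ / 4)
  have hG1 : ContDiff ℝ 1 (deriv G) := (contDiff_succ_iff_deriv (n := 1)).1 hG |>.2.2
  have hcrit {x : ℝ} (hx : deriv G x = 0) : |deriv F x| < ε := by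
    simpa [hx] using h1 x
  have hcrit2 {x : ℝ} (hx : deriv (deriv G) x = 0) : |deriv (deriv F) x| < ε := by
    simpa [hx] using h2 x
  have hrolle {x y z : ℝ} (hx : deriv G x = 0) (hy : deriv G y = 0) (hxy : x < y)
      (hx0 : 0 ≤ x) (hy4 : y ≤ 2 * (2 * Real.pi)) (hz : deriv G z = 0) (hzx : z = x ∨ z = y) :
      δ ≤ y - x := by
    by_contra! hlt
    obtain ⟨t, ht, ht0⟩ := exists_deriv_eq_zero hxy hG1.continuous.continuousOn (hx.trans hy.symm)
    have hz' : z ∈ Set.Icc x y := by rcases hzx with rfl | rfl <;> simp [hxy.le]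
    have hd := hδF t ⟨by linarith [ht.1], by linarith [ht.2]⟩ z
      ⟨by linarith [hz'.1], by linarith [hz'.2]⟩
      (by rw [abs_lt]; constructor <;> linarith [ht.1, ht.2, hz'.1, hz'.2])
    have a1 := hcrit hz
    have a2 := hcrit2 ht0
    have a3 := hβle z
    have a4 := abs_sub_abs_le_abs_sub (deriv (deriv F) z) (deriv (deriv F) t)
    rw [abs_sub_comm] at a4
    linarith
  refine ⟨fun θ hθ hθ2 => ?_, fun θ₁ θ₂ e1 e2 e12 => ?_⟩
  · linarith [hcrit hθ, hcrit2 hθ2, hβle θ]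
  · obtain ⟨i, hi⟩ := exists_add_int_mul_mem_Ico θ₂
    rw [← hGper.int_mul i θ₂] at e12
    rw [← hGper.deriv_real.int_mul i θ₂] at e2
    rcases exists_representative θ₁ (θ₂ + i * (2 * Real.pi)) with ⟨m, hm⟩ | ⟨j, hj1, hj2⟩
    · exact ⟨m + i, by push_cast; linarith⟩
    exfalso
    rw [← hGper.int_mul j θ₁] at e12
    rw [← hGper.deriv_real.int_mul j θ₁] at e1
    set x := θ₂ + i * (2 * Real.pi)
    set y := θ₁ + j * (2 * Real.pi)
    have e2' : deriv G (x + 2 * Real.pi) = 0 := (hGper.deriv_real x).trans e2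
    have hxy := hrolle e2 e1 hj1 hi.1 (by linarith [hi.2]) e2 (Or.inl rfl)
    have hyx := hrolle e1 e2' hj2 (by linarith [hi.1]) (by linarith [hi.2]) e1 (Or.inl rfl)
    have hμ' := hμle (x, y) ⟨⟨⟨hi.1, hi.2.le⟩, by linarith [hi.1], by linarith [hi.2]⟩,
      by simp only; linarith, by simp only; linarith⟩
    simp only at hμ'
    have a1 := hcrit e1
    have a2 := hcrit e2
    have a3 := abs_lt.1 (h0 x)
    have a4 := abs_lt.1 (h0 y)
    have a5 : |F x - F y| < 2 * ε := by
      rw [abs_lt]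
      constructor <;> linarith
    linarith

lemma MorseWithDistinctValues.const_mul_comp_add {F : ℝ → ℝ} (hM : MorseWithDistinctValues F)
    {a : ℝ} (ha : a ≠ 0) (φ : ℝ) : MorseWithDistinctValues (fun θ => a * F (θ + φ)) := by
  have h1 : deriv (fun θ => a * F (θ + φ)) = fun θ => a * deriv F (θ + φ) := by
    funext θ
    rw [deriv_const_mul_field, deriv_comp_add_const]
  have h2 : deriv (deriv (fun θ => a * F (θ + φ))) = fun θ => a * deriv (deriv F) (θ + φ) := by
    rw [h1]
    funext θ
    rw [deriv_const_mul_field, deriv_comp_add_const]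
  refine ⟨fun θ hθ => ?_, fun θ₁ θ₂ e1 e2 e12 => ?_⟩
  · rw [h1] at hθ
    rw [h2]
    exact mul_ne_zero ha (hM.1 _ ((mul_eq_zero.1 hθ).resolve_left ha))
  · rw [h1] at e1 e2
    obtain ⟨m, hm⟩ := hM.2 _ _ ((mul_eq_zero.1 e1).resolve_left ha)
      ((mul_eq_zero.1 e2).resolve_left ha) (mul_left_cancel₀ ha e12)
    exact ⟨m, by linarith⟩

lemma morseWithDistinctValues_cos : MorseWithDistinctValues Real.cos := by
  have h1 : deriv Real.cos = fun θ => -Real.sin θ := by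
    funext θ
    exact Real.deriv_cos
  have h2 : deriv (deriv Real.cos) = fun θ => -Real.cos θ := by
    rw [h1]
    funext θ
    simp
  refine ⟨fun θ hθ hθ2 => ?_, fun θ₁ θ₂ e1 e2 e12 => ?_⟩
  · rw [h1] at hθ
    rw [h2] at hθ2
    have := Real.sin_sq_add_cos_sq θ
    simp only [neg_eq_zero] at hθ hθ2
    simp [hθ, hθ2] at this
  · rw [h1] at e1 e2
    simp only [neg_eq_zero] at e1 e2
    exact Real.Angle.angle_eq_iff_two_pi_dvd_sub.1 (Real.Angle.cos_sin_inj e12 (e1.trans e2.symm))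

/-- All moments of the coefficient sequence are absolutely summable. -/
def RapidDecay (g : ℤ → ℂ) : Prop := ∀ p : ℕ, Summable fun j : ℤ => |(j : ℝ)| ^ p * ‖g j‖

/-- The real part of the sum of the trigonometric series with coefficients `g`. -/
def trig (g : ℤ → ℂ) (θ : ℝ) : ℝ := (∑' j : ℤ, g j * exp (I * (j : ℂ) * (θ : ℂ))).re

/-- The coefficients of the derivative of a trigonometric series. -/
def derivCoef (g : ℤ → ℂ) (j : ℤ) : ℂ := I * j * g j

lemma norm_exp_I_mul_int_mul (j : ℤ) (θ : ℝ) : ‖exp (I * (j : ℂ) * (θ : ℂ))‖ = 1 := by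
  rw [show I * (j : ℂ) * (θ : ℂ) = ((j * θ : ℝ) : ℂ) * I by push_cast; ring]
  exact norm_exp_ofReal_mul_I _

lemma norm_derivCoef (g : ℤ → ℂ) (j : ℤ) : ‖derivCoef g j‖ = |(j : ℝ)| * ‖g j‖ := by
  simp [derivCoef]

namespace RapidDecay

variable {g h : ℤ → ℂ}

lemma summable_norm (hg : RapidDecay g) : Summable fun j => ‖g j‖ := by
  simpa using hg 0

protected lemma deriv (hg : RapidDecay g) : RapidDecay (derivCoef g) := by
  intro p
  refine (hg (p + 1)).congr fun j => ?_
  rw [norm_derivCoef]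
  ring

lemma summable_term (hg : RapidDecay g) (θ : ℝ) :
    Summable fun j : ℤ => g j * exp (I * (j : ℂ) * (θ : ℂ)) :=
  Summable.of_norm (by simpa [norm_exp_I_mul_int_mul] using hg.summable_norm)

lemma of_norm_le (hg : RapidDecay g) (hle : ∀ j, ‖h j‖ ≤ ‖g j‖) : RapidDecay h := fun p =>
  (hg p).of_nonneg_of_le (fun _ => by positivity) fun j => by gcongr; exact hle j

lemma const_mul (hg : RapidDecay g) (a : ℂ) : RapidDecay (fun j => a * g j) := fun p =>
  ((hg p).mul_left ‖a‖).congr fun j => by rw [norm_mul]; ring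

lemma hasDerivAt_trig (hg : RapidDecay g) (θ : ℝ) :
    HasDerivAt (trig g) (trig (derivCoef g) θ) θ := by
  have h := hasDerivAt_tsum (𝕜 := ℝ)
    (g := fun (j : ℤ) (θ : ℝ) => g j * exp (I * (j : ℂ) * (θ : ℂ)))
    (g' := fun j θ => derivCoef g j * exp (I * (j : ℂ) * (θ : ℂ))) (y₀ := 0)
    hg.deriv.summable_norm (fun j y => by
      have h1 : HasDerivAt (fun y : ℝ => I * (j : ℂ) * (y : ℂ)) (I * j) y := by
        simpa using (hasDerivAt_id y).ofReal_comp.const_mul (I * (j : ℂ))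
      refine (h1.cexp.const_mul (g j)).congr_deriv ?_
      simp only [derivCoef]
      ring) (fun j y => by simp [norm_exp_I_mul_int_mul]) (hg.summable_term 0) θ
  exact reCLM.hasFDerivAt.comp_hasDerivAt θ h

lemma deriv_trig (hg : RapidDecay g) : deriv (trig g) = trig (derivCoef g) :=
  funext fun θ => (hg.hasDerivAt_trig θ).deriv

lemma contDiff_trig (hg : RapidDecay g) (n : ℕ) : ContDiff ℝ n (trig g) := by
  induction n generalizing g with
  | zero =>
    exact contDiff_zero.2 (Differentiable.continuous
      fun θ => (hg.hasDerivAt_trig θ).differentiableAt)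
  | succ n ih =>
    push_cast
    refine contDiff_succ_iff_deriv.2
      ⟨fun θ => (hg.hasDerivAt_trig θ).differentiableAt, by simp, ?_⟩
    rw [hg.deriv_trig]
    exact ih hg.deriv

lemma trig_add (hg : RapidDecay g) (hh : RapidDecay h) (θ : ℝ) :
    trig (fun j => g j + h j) θ = trig g θ + trig h θ := by
  simp only [trig, add_mul]
  rw [(hg.summable_term θ).tsum_add (hh.summable_term θ), add_re]

lemma trig_sub (hg : RapidDecay g) (hh : RapidDecay h) (θ : ℝ) :
    trig (fun j => g j - h j) θ = trig g θ - trig h θ := by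
  simp only [trig, sub_mul]
  rw [(hg.summable_term θ).tsum_sub (hh.summable_term θ), sub_re]

end RapidDecay

lemma abs_trig_le {g : ℤ → ℂ} {u : ℤ → ℝ} (hu : Summable u) (hle : ∀ j, ‖g j‖ ≤ u j)
    (θ : ℝ) : |trig g θ| ≤ ∑' j, u j :=
  (abs_re_le_norm _).trans (tsum_of_norm_bounded hu.hasSum fun j => by
    simpa [norm_exp_I_mul_int_mul] using hle j)

lemma trig_const_mul (g : ℤ → ℂ) (a θ : ℝ) : trig (fun j => a * g j) θ = a * trig g θ := by
  simp only [trig, mul_assoc]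
  rw [tsum_mul_left, re_ofReal_mul]

lemma trig_periodic (g : ℤ → ℂ) : Function.Periodic (trig g) (2 * Real.pi) := by
  intro θ
  simp only [trig]
  congr 2
  funext j
  rw [show I * (j : ℂ) * ((θ + 2 * Real.pi : ℝ) : ℂ) =
    I * j * θ + j * (2 * Real.pi * I) by push_cast; ring, exp_add, exp_int_mul_two_pi_mul_I,
    mul_one]

lemma trig_comp_add (g : ℤ → ℂ) (φ θ : ℝ) :
    trig g (θ + φ) = trig (fun j => exp (I * j * φ) * g j) θ := by
  simp only [trig]
  congr 2
  funext j
  rw [show I * (j : ℂ) * ((θ + φ : ℝ) : ℂ) = I * j * θ + I * j * φ by push_cast; ring, exp_add]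
  ring

lemma summable_abs_pow_mul_exp_neg {a : ℝ} (ha : 0 < a) (p : ℕ) :
    Summable fun j : ℤ => |(j : ℝ)| ^ p * Real.exp (-(a * |(j : ℝ)|)) := by
  have h : Summable fun n : ℕ => (n : ℝ) ^ p * Real.exp (-(a * n)) := by
    simpa only [neg_mul] using Real.summable_pow_mul_exp_neg_nat_mul p ha
  apply Summable.of_nat_of_neg <;> simpa using h

lemma rapidDecay_of_norm_le {g : ℤ → ℂ} {a : ℝ} (ha : 0 < a)
    (hg : ∀ j, ‖g j‖ ≤ Real.exp (-(a * |(j : ℝ)|))) : RapidDecay g := fun p =>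
  (summable_abs_pow_mul_exp_neg ha p).of_nonneg_of_le (fun _ => by positivity) fun j => by
    gcongr
    exact hg j

/-- For trigonometric series, being Morse with distinct critical values is an open condition with
respect to exponentially weighted norms of the coefficients. -/
lemma RapidDecay.exists_morse_stable {g : ℤ → ℂ} (hg : RapidDecay g)
    (hM : MorseWithDistinctValues (trig g)) {a : ℝ} (ha : 0 < a) :
    ∃ ε > 0, ∀ h : ℤ → ℂ, RapidDecay h →
      (∀ j, ‖h j - g j‖ ≤ ε * Real.exp (-(a * |(j : ℝ)|))) → MorseWithDistinctValues (trig h) := by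
  obtain ⟨η, hη, hstable⟩ := hM.exists_stable (hg.contDiff_trig 2) (trig_periodic g)
  set C : ℕ → ℝ := fun p => ∑' j : ℤ, |(j : ℝ)| ^ p * Real.exp (-(a * |(j : ℝ)|)) with hC
  have hC0 (p : ℕ) : 0 ≤ C p := tsum_nonneg fun j => by positivity
  set M := C 0 + C 1 + C 2 + 1
  have hM0 : 0 < M := by linarith [hC0 0, hC0 1, hC0 2]
  have hsmall (p : ℕ) (hp : C p < M) : η / M * C p < η := by
    rw [div_mul_eq_mul_div, div_lt_iff₀ hM0]
    gcongr
  refine ⟨η / M, by positivity, fun h hh hle => ?_⟩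
  have hbound (p : ℕ) {f : ℤ → ℂ}
      (hfle : ∀ j, ‖f j‖ = |(j : ℝ)| ^ p * ‖h j - g j‖) (θ : ℝ) : |trig f θ| ≤ η / M * C p := by
    rw [hC, ← tsum_mul_left]
    refine abs_trig_le ((summable_abs_pow_mul_exp_neg ha p).mul_left _) (fun j => ?_) θ
    rw [hfle, mul_left_comm]
    gcongr
    exact hle j
  have hd1 : derivCoef (fun j => h j - g j) = fun j => derivCoef h j - derivCoef g j := by
    funext j
    simp only [derivCoef]
    ring
  have hd2 : derivCoef (derivCoef (fun j => h j - g j)) =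
      fun j => derivCoef (derivCoef h) j - derivCoef (derivCoef g) j := by
    rw [hd1]
    funext j
    simp only [derivCoef]
    ring
  refine hstable _ (hh.contDiff_trig 2) (trig_periodic h) (fun θ => ?_) (fun θ => ?_) fun θ => ?_
  · rw [← hh.trig_sub hg]
    exact (hbound 0 (fun j => by simp) θ).trans_lt
      (hsmall 0 (by linarith [hC0 1, hC0 2]))
  · rw [hh.deriv_trig, hg.deriv_trig, ← hh.deriv.trig_sub hg.deriv, ← hd1]
    exact (hbound 1 (fun j => by rw [norm_derivCoef, pow_one]) θ).trans_lt
      (hsmall 1 (by linarith [hC0 0, hC0 2]))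
  · rw [hh.deriv_trig, hg.deriv_trig, hh.deriv.deriv_trig, hg.deriv.deriv_trig,
      ← hh.deriv.deriv.trig_sub hg.deriv.deriv, ← hd2]
    exact (hbound 2
      (fun j => by rw [norm_derivCoef, norm_derivCoef]; ring) θ).trans_lt
      (hsmall 2 (by linarith [hC0 0, hC0 1]))

/-- The Fourier coefficients of `quadTrig w`. -/
def quadCoef (w : ℝ × ℝ × ℝ × ℝ) (j : ℤ) : ℂ :=
  if j = 1 then ⟨w.1, -w.2.1⟩ else if j = -1 then ⟨w.1, w.2.1⟩
  else if j = 2 then ⟨w.2.2.1, -w.2.2.2⟩ else if j = -2 then ⟨w.2.2.1, w.2.2.2⟩ else 0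

lemma quadCoef_neg (w : ℝ × ℝ × ℝ × ℝ) (j : ℤ) :
    quadCoef w (-j) = (starRingEnd ℂ) (quadCoef w j) := by
  simp only [quadCoef]
  by_cases h1 : j = 1
  · subst h1; apply Complex.ext <;> simp
  by_cases h2 : j = -1
  · subst h2; apply Complex.ext <;> simp
  by_cases h3 : j = 2
  · subst h3; apply Complex.ext <;> simp
  by_cases h4 : j = -2
  · subst h4; apply Complex.ext <;> simp
  · rw [if_neg (by omega), if_neg (by omega), if_neg (by omega), if_neg (by omega), if_neg h1,
      if_neg h2, if_neg h3, if_neg h4, map_zero]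

lemma quadCoef_eq_zero (w : ℝ × ℝ × ℝ × ℝ) {j : ℤ} (hj : j ∉ ({1, -1, 2, -2} : Finset ℤ)) :
    quadCoef w j = 0 := by
  simp only [Finset.mem_insert, Finset.mem_singleton, not_or] at hj
  simp [quadCoef, hj]

lemma rapidDecay_quadCoef (w : ℝ × ℝ × ℝ × ℝ) : RapidDecay (quadCoef w) := fun p =>
  summable_of_ne_finset_zero (s := {1, -1, 2, -2}) fun j hj => by simp [quadCoef_eq_zero w hj]

lemma trig_quadCoef (w : ℝ × ℝ × ℝ × ℝ) : trig (quadCoef w) = quadTrig w := by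
  funext θ
  have hre (x : ℝ) : (exp (x * I)).re = Real.cos x := exp_ofReal_mul_I_re x
  have him (x : ℝ) : (exp (x * I)).im = Real.sin x := exp_ofReal_mul_I_im x
  rw [trig, tsum_eq_sum (s := {1, -1, 2, -2}) fun j hj => by simp [quadCoef_eq_zero w hj]]
  rw [Finset.sum_insert (by decide), Finset.sum_insert (by decide), Finset.sum_insert (by decide),
    Finset.sum_singleton]
  have e (j : ℤ) : I * (j : ℂ) * (θ : ℂ) = ((j * θ : ℝ) : ℂ) * I := by push_cast; ring
  simp only [e, add_re, mul_re, hre, him, quadCoef]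
  simp [quadTrig]
  ring

/-- A small perturbation of the first two harmonics yields a Morse function with distinct critical
values and a first harmonic which is not too small. -/
lemma exists_morse_perturbation {F : ℝ → ℝ} (hF : ContDiff ℝ 3 F)
    (hper : Function.Periodic F (2 * Real.pi)) (z : ℂ) {t ρ : ℝ} (ht : 0 ≤ t) (hρ : 0 < ρ) :
    ∃ w, MorseWithDistinctValues (fun θ => F θ + quadTrig w θ) ∧ ‖quadCoef w 1‖ ≤ t + ρ ∧
      ‖quadCoef w 2‖ ≤ ρ ∧ t - ρ ≤ ‖z + quadCoef w 1‖ := by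
  obtain ⟨x, hx, hxz⟩ : ∃ x : ℝ, |x| = t ∧ t ≤ ‖z + x‖ := by
    by_contra! h
    have h1 := h t (abs_of_nonneg ht)
    have h2 := h (-t) (by rw [abs_neg, abs_of_nonneg ht])
    have h3 := norm_sub_le (z + (t : ℂ)) (z + ((-t : ℝ) : ℂ))
    rw [show z + (t : ℂ) - (z + ((-t : ℝ) : ℂ)) = ((2 * t : ℝ) : ℂ) by push_cast; ring,
      norm_real, Real.norm_of_nonneg (by positivity)] at h3
    linarith
  obtain ⟨w, hw, hwx⟩ := Metric.dense_iff.1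
    (dense_morseWithDistinctValues_add_quadTrig hF hper) (x, 0, 0, 0) (ρ / 2) (by positivity)
  obtain ⟨a, b, c, d⟩ := w
  simp only [Metric.mem_ball, Prod.dist_eq, max_lt_iff, Real.dist_eq, sub_zero] at hw
  have h1 : ‖quadCoef (a, b, c, d) 1 - x‖ ≤ ρ := by
    refine (norm_le_abs_re_add_abs_im _).trans ?_
    simp [quadCoef]
    linarith
  have h2 : ‖quadCoef (a, b, c, d) 2‖ ≤ ρ := by
    refine (norm_le_abs_re_add_abs_im _).trans ?_
    simp [quadCoef]
    linarith
  refine ⟨_, hwx, ?_, h2, ?_⟩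
  · have := norm_add_le (quadCoef (a, b, c, d) 1 - x) (x : ℂ)
    rw [sub_add_cancel, norm_real, Real.norm_eq_abs, hx] at this
    linarith
  · have := norm_sub_le (z + quadCoef (a, b, c, d) 1) (quadCoef (a, b, c, d) 1 - x)
    rw [show z + quadCoef (a, b, c, d) 1 - (quadCoef (a, b, c, d) 1 - x) = z + x by ring] at this
    linarith

/-- The coefficients of the Fourier projection onto the modes proportional to `k`. -/
def lineCoef {n : ℕ} (c : (Fin n → ℤ) → ℂ) (k : Fin n → ℤ) (j : ℤ) : ℂ :=
  if j = 0 then 0 else c (j • k)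

lemma projR_eq_trig {n : ℕ} (c : (Fin n → ℤ) → ℂ) (k : Fin n → ℤ) :
    projR c k = trig (lineCoef c k) := by
  funext θ
  simp only [projR, projC, trig, lineCoef, ite_mul, zero_mul]

section Lattice

variable {n : ℕ} {k l : Fin n → ℤ}

lemma norm1_zsmul (j : ℤ) (k : Fin n → ℤ) : norm1 (j • k) = j.natAbs * norm1 k := by
  simp [norm1, Int.natAbs_mul, Finset.mul_sum]

lemma ne_zero_of_mem_gen (hk : k ∈ gen n) : k ≠ 0 := by
  rintro rfl
  obtain ⟨⟨j, hj, -⟩, -⟩ := hk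
  simp at hj

lemma one_le_norm1 (hk : k ∈ gen n) : 1 ≤ norm1 k := by
  rw [Nat.one_le_iff_ne_zero]
  intro h
  refine ne_zero_of_mem_gen hk (funext fun i => ?_)
  simpa using (Finset.sum_eq_zero_iff.1 h) i (Finset.mem_univ i)

lemma gcd_zsmul_of_mem_gen (hk : k ∈ gen n) (j : ℤ) :
    Finset.univ.gcd (fun i => ((j • k) i).natAbs) = j.natAbs := by
  simp only [Pi.smul_apply, smul_eq_mul, Int.natAbs_mul]
  rw [Finset.gcd_mul_left, hk.2]
  simp

lemma neg_notMem_Zstar (hk : k ∈ Zstar n) : -k ∉ Zstar n := by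
  rintro ⟨i, hi, hi'⟩
  obtain ⟨j, hj, hj'⟩ := hk
  rw [Pi.neg_apply] at hi
  rcases lt_trichotomy i j with h | rfl | h
  · have := hj' i h
    omega
  · omega
  · have := hi' j h
    rw [Pi.neg_apply] at this
    omega

/-- Nonzero multiples of generators determine the generator and the factor. -/
lemma zsmul_gen_injective (hk : k ∈ gen n) (hl : l ∈ gen n) {i j : ℤ} (hi : i ≠ 0)
    (h : i • k = j • l) : k = l ∧ i = j := by
  have habs : i.natAbs = j.natAbs := by
    rw [← gcd_zsmul_of_mem_gen hk, ← gcd_zsmul_of_mem_gen hl, h]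
  rcases Int.natAbs_eq_natAbs_iff.1 habs with rfl | rfl
  · exact ⟨smul_right_injective _ hi h, rfl⟩
  · exfalso
    have h' : j • (-k) = j • l := by rw [smul_neg, ← neg_smul, h]
    have hkl : -k = l := smul_right_injective _ (by omega) h'
    exact neg_notMem_Zstar hk.1 (hkl ▸ hl.1)

lemma finite_norm1_lt (n N : ℕ) : {k : Fin n → ℤ | norm1 k < N}.Finite := by
  refine (Set.Finite.pi' fun _ : Fin n => Set.finite_Icc (-(N : ℤ)) N).subset fun k hk i => ?_
  have h1 : (k i).natAbs ≤ norm1 k :=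
    Finset.single_le_sum (f := fun i => (k i).natAbs) (fun _ _ => Nat.zero_le _)
      (Finset.mem_univ i)
  have h2 : norm1 k < N := hk
  simp only [Set.mem_Icc]
  omega

end Lattice

section Ball

variable {n : ℕ} {s : ℝ} {c c' : (Fin n → ℤ) → ℂ} {k : Fin n → ℤ}

lemma norm_mul_exp_le_iff (z : ℂ) (x b : ℝ) :
    ‖z‖ * Real.exp x ≤ b ↔ ‖z‖ ≤ b * Real.exp (-x) := by
  rw [Real.exp_neg, ← div_eq_mul_inv, le_div_iff₀ (Real.exp_pos x)]

lemma norm_lineCoef_le {b : ℝ} (hb : 0 ≤ b) (hc : ∀ m, ‖c m‖ * Real.exp (s * norm1 m) ≤ b)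
    (k : Fin n → ℤ) (j : ℤ) :
    ‖lineCoef c k j‖ ≤ b * Real.exp (-(s * (|(j : ℝ)| * norm1 k))) := by
  unfold lineCoef
  split_ifs
  · rw [norm_zero]
    positivity
  · have := (norm_mul_exp_le_iff _ _ _).1 (hc (j • k))
    rwa [norm1_zsmul, Nat.cast_mul, Nat.cast_natAbs, Int.cast_abs] at this

lemma exp_neg_mul_norm1_le (hs : 0 < s) (hk : k ∈ gen n) (j : ℤ) :
    Real.exp (-(s * (|(j : ℝ)| * norm1 k))) ≤ Real.exp (-(s * |(j : ℝ)|)) := by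
  have h1 : (1 : ℝ) ≤ norm1 k := by exact_mod_cast one_le_norm1 hk
  gcongr
  exact le_mul_of_one_le_right (abs_nonneg _) h1

lemma InBall.rapidDecay_lineCoef (hc : InBall n s c) (hs : 0 < s) (hk : k ∈ gen n) :
    RapidDecay (lineCoef c k) :=
  rapidDecay_of_norm_le hs fun j => (norm_lineCoef_le zero_le_one hc.bound k j).trans
    (by rw [one_mul]; exact exp_neg_mul_norm1_le hs hk j)

lemma InBall.bddAbove_dist (hc : InBall n s c) (hc' : InBall n s c') :
    BddAbove (Set.range fun k : Fin n → ℤ => ‖c k - c' k‖ * Real.exp (s * norm1 k)) := by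
  refine ⟨2, ?_⟩
  rintro _ ⟨k, rfl⟩
  have h1 := hc.bound k
  have h2 := hc'.bound k
  have h3 := mul_le_mul_of_nonneg_right (norm_sub_le (c k) (c' k)) (Real.exp_pos (s * norm1 k)).le
  simp only
  linarith

lemma InBall.le_distS (hc : InBall n s c) (hc' : InBall n s c') (k : Fin n → ℤ) :
    ‖c k - c' k‖ * Real.exp (s * norm1 k) ≤ distS s c c' :=
  le_ciSup (hc.bddAbove_dist hc') k

/-- The projections onto high modes whose first harmonic has at least a fixed weighted size are
Morse functions with distinct critical values. -/
lemma exists_morse_of_le_norm1 (n : ℕ) (hs : 0 < s) {d : ℝ} (hd : 0 < d) :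
    ∃ N : ℕ, ∀ c, InBall n s c → ∀ k ∈ gen n, N ≤ norm1 k →
      d ≤ ‖c k‖ * Real.exp (s * norm1 k) → MorseWithDistinctValues (projR c k) := by
  set w : ℝ × ℝ × ℝ × ℝ := (1 / 2, 0, 0, 0)
  have hcos : trig (quadCoef w) = Real.cos := by
    funext θ
    rw [trig_quadCoef]
    simp [quadTrig, w]
  obtain ⟨ε, hε, hstable⟩ := (rapidDecay_quadCoef w).exists_morse_stable
    (hcos ▸ morseWithDistinctValues_cos) (half_pos hs)
  obtain ⟨N, hN⟩ : ∃ N : ℕ, ∀ K : ℕ, N ≤ K → Real.exp (-(s * (K - 1))) ≤ 2 * d * ε := by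
    have ht : Filter.Tendsto (fun K : ℕ => Real.exp (-(s * ((K : ℝ) - 1)))) Filter.atTop
        (nhds 0) := by
      refine Real.tendsto_exp_neg_atTop_nhds_zero.comp (Filter.Tendsto.const_mul_atTop hs ?_)
      exact Filter.tendsto_atTop_add_const_right _ (-1) tendsto_natCast_atTop_atTop
    exact Filter.eventually_atTop.1 (ht.eventually_le_const (by positivity))
  refine ⟨N, fun c hc k hk hNk hdk => ?_⟩
  set K : ℝ := (norm1 k : ℝ)
  have hK : 1 ≤ K := Nat.one_le_cast.2 (one_le_norm1 hk)
  set r := ‖c k‖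
  have hr : d * Real.exp (-(s * K)) ≤ r := by
    rw [Real.exp_neg, ← div_eq_mul_inv, div_le_iff₀ (Real.exp_pos _)]
    exact hdk
  have hr0 : 0 < r := lt_of_lt_of_le (by positivity) hr
  set φ := arg (c k)
  have hpolar : (r : ℂ) * exp (φ * I) = c k := norm_mul_exp_arg_mul_I (c k)
  have hrC : (r : ℂ) ≠ 0 := by exact_mod_cast hr0.ne'
  set h : ℤ → ℂ := fun j =>
    ((1 / (2 * r) : ℝ) : ℂ) * (exp (I * j * ((-φ : ℝ) : ℂ)) * lineCoef c k j)
    with hh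
  have hg := hc.rapidDecay_lineCoef hs hk
  have hnorm (j : ℤ) : ‖h j‖ = 1 / (2 * r) * ‖lineCoef c k j‖ := by
    rw [hh, norm_mul, norm_mul, norm_exp_I_mul_int_mul, one_mul, norm_real,
      Real.norm_of_nonneg (by positivity)]
  have hrot : projR c k = fun θ => 2 * r * trig h (θ + φ) := by
    funext θ
    rw [hh, trig_const_mul, ← trig_comp_add, projR_eq_trig, add_neg_cancel_right, ← mul_assoc,
      mul_one_div_cancel (by positivity), one_mul]
  have h1 : h 1 = 1 / 2 := by
    simp only [hh, lineCoef, one_ne_zero, if_false, one_zsmul, ← hpolar]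
    rw [mul_left_comm (exp _), ← exp_add]
    push_cast
    rw [show I * 1 * -(φ : ℂ) + φ * I = 0 by ring, exp_zero]
    field_simp
  have hm1 : h (-1) = 1 / 2 := by
    have hcm : c (-k) = r * exp (-(φ * I)) := by
      rw [hc.real, ← hpolar, map_mul, conj_ofReal, ← exp_conj, map_mul, conj_ofReal, conj_I,
        mul_neg]
    simp only [hh, lineCoef, show (-1 : ℤ) ≠ 0 by decide, if_false, neg_smul, one_zsmul, hcm]
    rw [mul_left_comm (exp _), ← exp_add]
    push_cast
    rw [show I * -1 * -(φ : ℂ) + -(φ * I) = 0 by ring, exp_zero]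
    field_simp
  rw [hrot]
  refine (hstable h ?_ fun j => ?_).const_mul_comp_add (by positivity) φ
  · refine (hg.const_mul ((1 / (2 * r) : ℝ) : ℂ)).of_norm_le fun j => ?_
    rw [hnorm, norm_mul, norm_real, Real.norm_of_nonneg (by positivity)]
  by_cases hj1 : j = 1
  · subst hj1
    rw [h1, show quadCoef w 1 = 1 / 2 by apply Complex.ext <;> simp [quadCoef, w], sub_self,
      norm_zero]
    positivity
  by_cases hjm1 : j = -1
  · subst hjm1
    rw [hm1, show quadCoef w (-1) = 1 / 2 by apply Complex.ext <;> simp [quadCoef, w], sub_self,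
      norm_zero]
    positivity
  have hq : quadCoef w j = 0 := by
    simp only [quadCoef, hj1, hjm1, if_false, w]
    split_ifs <;> apply Complex.ext <;> simp
  rw [hq, sub_zero]
  by_cases hj0 : j = 0
  · subst hj0
    simp only [hh, lineCoef, if_true, mul_zero, norm_zero]
    positivity
  have hj2 : (2 : ℝ) ≤ |(j : ℝ)| := by
    have : (2 : ℤ) ≤ |j| := by
      rcases abs_cases j with ⟨h, _⟩ | ⟨h, _⟩ <;> omega
    exact_mod_cast this
  have hline := norm_lineCoef_le zero_le_one hc.bound k j
  rw [one_mul] at hline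
  rw [hnorm, one_div_mul_eq_div, div_le_iff₀ (by positivity)]
  calc ‖lineCoef c k j‖ ≤ Real.exp (-(s * (|(j : ℝ)| * K))) := hline
    _ ≤ Real.exp (-(s * (K - 1))) * (Real.exp (-(s / 2 * |(j : ℝ)|)) * Real.exp (-(s * K))) := by
        rw [← Real.exp_add, ← Real.exp_add, Real.exp_le_exp]
        have : 0 ≤ s * ((|(j : ℝ)| - 2) * (K - 1) + (|(j : ℝ)| - 2) / 2) :=
          mul_nonneg hs.le (add_nonneg (mul_nonneg (by linarith) (by linarith)) (by linarith))
        linarith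
    _ ≤ 2 * d * ε * (Real.exp (-(s / 2 * |(j : ℝ)|)) * Real.exp (-(s * K))) := by
        gcongr
        exact hN _ hNk
    _ = ε * Real.exp (-(s / 2 * |(j : ℝ)|)) * (2 * (d * Real.exp (-(s * K)))) := by ring
    _ ≤ ε * Real.exp (-(s / 2 * |(j : ℝ)|)) * (2 * r) := by gcongr

/-- Functions whose first harmonics along all generators are uniformly bounded below in the weighted
norm, and whose one-dimensional projections are Morse with distinct critical values. -/
def uniformGset (n : ℕ) (s : ℝ) : Set ((Fin n → ℤ) → ℂ) :=
  {c | InBall n s c ∧ (∃ d > 0, ∀ k ∈ gen n, d ≤ ‖c k‖ * Real.exp (s * norm1 k)) ∧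
    ∀ k ∈ gen n, MorseWithDistinctValues (projR c k)}

lemma uniformGset_subset_Gset (n : ℕ) (s : ℝ) : uniformGset n s ⊆ Gset n s := by
  rintro c ⟨hc, ⟨d, hd, hdc⟩, hM⟩
  refine ⟨hc, ⟨d, hd, 0, fun k hk _ => (hdc k hk).trans ?_⟩, hM⟩
  exact le_mul_of_one_le_right (by positivity)
    (one_le_pow₀ (by exact_mod_cast one_le_norm1 hk))

lemma exists_ball_subset_uniformGset (hs : 0 < s) (hc : c ∈ uniformGset n s) :
    ∃ ε > 0, ∀ c', InBall n s c' → distS s c c' < ε → c' ∈ uniformGset n s := by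
  obtain ⟨hcB, ⟨d, hd, hdc⟩, hM⟩ := hc
  obtain ⟨N, hN⟩ := exists_morse_of_le_norm1 n hs (half_pos hd)
  have hloc : ∀ k ∈ gen n, ∃ ε > 0, ∀ c', InBall n s c' → distS s c c' < ε →
      MorseWithDistinctValues (projR c' k) := by
    intro k hk
    obtain ⟨ε, hε, hstable⟩ := (hcB.rapidDecay_lineCoef hs hk).exists_morse_stable
      (projR_eq_trig c k ▸ hM k hk) hs
    refine ⟨ε, hε, fun c' hc' hdist => ?_⟩
    rw [projR_eq_trig]
    refine hstable _ (hc'.rapidDecay_lineCoef hs hk) fun j => ?_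
    have h1 := norm_lineCoef_le (c := fun m => c' m - c m) hε.le
      (fun m => by rw [norm_sub_rev]; exact (hcB.le_distS hc' m).trans hdist.le) k j
    have h2 : lineCoef (fun m => c' m - c m) k j = lineCoef c' k j - lineCoef c k j := by
      unfold lineCoef
      split_ifs <;> simp
    rw [← h2]
    exact h1.trans (mul_le_mul_of_nonneg_left (exp_neg_mul_norm1_le hs hk j) hε.le)
  choose! e he hstable using hloc
  obtain ⟨ε, hε, hεle⟩ : ∃ ε > 0, ∀ k ∈ gen n, norm1 k < N → ε ≤ e k := by
    have hfin : {k | k ∈ gen n ∧ norm1 k < N}.Finite :=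
      (finite_norm1_lt n N).subset fun k hk => hk.2
    obtain ⟨ε, hε, hle⟩ := hfin.isCompact.exists_forall_le' (f := e) (hfin.continuousOn _) (a := 0)
      fun k hk => he k hk.1
    exact ⟨ε, hε, fun k hk hkN => hle k ⟨hk, hkN⟩⟩
  refine ⟨min ε (d / 2), by positivity, fun c' hc' hdist => ?_⟩
  have hlow : ∀ k ∈ gen n, d / 2 ≤ ‖c' k‖ * Real.exp (s * norm1 k) := by
    intro k hk
    have h1 := hdc k hk
    have h2 := (hcB.le_distS hc' k).trans_lt (hdist.trans_le (min_le_right _ _))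
    have h3 := mul_le_mul_of_nonneg_right (norm_sub_norm_le (c k) (c' k))
      (Real.exp_pos (s * norm1 k)).le
    linarith
  refine ⟨hc', ⟨d / 2, half_pos hd, hlow⟩, fun k hk => ?_⟩
  rcases lt_or_ge (norm1 k) N with h | h
  · exact hstable k hk c' hc' (hdist.trans_le ((min_le_left _ _).trans (hεle k hk h)))
  · exact hN c' hc' k hk h (hlow k hk)

open Classical in
/-- The Fourier coefficients with prescribed quadratic trigonometric projections along all
generators. -/
def genCoef {n : ℕ} (w : (Fin n → ℤ) → ℝ × ℝ × ℝ × ℝ) (m : Fin n → ℤ) : ℂ :=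
  if h : m ≠ 0 ∧ ∃ p : (Fin n → ℤ) × ℤ, p.1 ∈ gen n ∧ m = p.2 • p.1 then
    quadCoef (w h.2.choose.1) h.2.choose.2 else 0

lemma quadCoef_zero (w : ℝ × ℝ × ℝ × ℝ) : quadCoef w 0 = 0 := by
  simp [quadCoef]

lemma genCoef_zsmul (w : (Fin n → ℤ) → ℝ × ℝ × ℝ × ℝ) (hk : k ∈ gen n) (j : ℤ) :
    genCoef w (j • k) = quadCoef (w k) j := by
  unfold genCoef
  by_cases hj : j = 0
  · simp [hj, quadCoef_zero]
  · have h : j • k ≠ 0 ∧ ∃ p : (Fin n → ℤ) × ℤ, p.1 ∈ gen n ∧ j • k = p.2 • p.1 :=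
      ⟨smul_ne_zero hj (ne_zero_of_mem_gen hk), (k, j), hk, rfl⟩
    rw [dif_pos h]
    obtain ⟨h1, h2⟩ := zsmul_gen_injective hk h.2.choose_spec.1 hj h.2.choose_spec.2
    rw [← h1, ← h2]

lemma genCoef_eq_zero (w : (Fin n → ℤ) → ℝ × ℝ × ℝ × ℝ) {m : Fin n → ℤ}
    (hm : ¬ ∃ k ∈ gen n, ∃ j : ℤ, m = j • k) : genCoef w m = 0 := by
  unfold genCoef
  rw [dif_neg]
  rintro ⟨-, ⟨k, j⟩, hk, hj⟩
  exact hm ⟨k, hk, j, hj⟩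

lemma genCoef_neg (w : (Fin n → ℤ) → ℝ × ℝ × ℝ × ℝ) (m : Fin n → ℤ) :
    genCoef w (-m) = (starRingEnd ℂ) (genCoef w m) := by
  by_cases hm : ∃ k ∈ gen n, ∃ j : ℤ, m = j • k
  · obtain ⟨k, hk, j, rfl⟩ := hm
    rw [← neg_smul, genCoef_zsmul w hk, genCoef_zsmul w hk, quadCoef_neg]
  · rw [genCoef_eq_zero w hm, genCoef_eq_zero, map_zero]
    rintro ⟨k, hk, j, hj⟩
    exact hm ⟨k, hk, -j, by rw [neg_smul, ← hj, neg_neg]⟩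

lemma norm_genCoef_mul_exp_le {w : (Fin n → ℤ) → ℝ × ℝ × ℝ × ℝ} {b : ℝ} (hb : 0 ≤ b)
    (h1 : ∀ k ∈ gen n, ‖quadCoef (w k) 1‖ * Real.exp (s * norm1 k) ≤ b)
    (h2 : ∀ k ∈ gen n, ‖quadCoef (w k) 2‖ * Real.exp (s * (2 * norm1 k)) ≤ b) (m : Fin n → ℤ) :
    ‖genCoef w m‖ * Real.exp (s * norm1 m) ≤ b := by
  by_cases hm : ∃ k ∈ gen n, ∃ j : ℤ, m = j • k
  · obtain ⟨k, hk, j, rfl⟩ := hm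
    rw [genCoef_zsmul w hk, norm1_zsmul]
    by_cases hj : j ∈ ({1, -1, 2, -2} : Finset ℤ)
    · simp only [Finset.mem_insert, Finset.mem_singleton] at hj
      rcases hj with rfl | rfl | rfl | rfl
      · simpa using h1 k hk
      · simpa [quadCoef_neg (w k) 1] using h1 k hk
      · simpa using h2 k hk
      · simpa [quadCoef_neg (w k) 2] using h2 k hk
    · simpa [quadCoef_eq_zero _ hj] using hb
  · simpa [genCoef_eq_zero w hm] using hb

lemma exists_mem_uniformGset_distS_lt (hs : 0 < s) (hc : InBall n s c) {ε : ℝ} (hε : 0 < ε) :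
    ∃ c' ∈ uniformGset n s, distS s c c' < ε := by
  set η := min ε 1 / 8 with hη
  have hη0 : 0 < η := by positivity
  have hηε : 8 * η ≤ ε := by rw [hη]; linarith [min_le_left ε 1]
  have hη1 : 8 * η ≤ 1 := by rw [hη]; linarith [min_le_right ε 1]
  have hpert : ∀ k ∈ gen n, ∃ w,
      MorseWithDistinctValues (fun θ => (1 - 3 * η) * projR c k θ + quadTrig w θ) ∧
      ‖quadCoef w 1‖ ≤ 2 * η * Real.exp (-(s * norm1 k)) + η * Real.exp (-(s * (2 * norm1 k))) ∧
      ‖quadCoef w 2‖ ≤ η * Real.exp (-(s * (2 * norm1 k))) ∧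
      2 * η * Real.exp (-(s * norm1 k)) - η * Real.exp (-(s * (2 * norm1 k))) ≤
        ‖((1 - 3 * η : ℝ) : ℂ) * c k + quadCoef w 1‖ := by
    intro k hk
    have hF : ContDiff ℝ 3 (projR c k) := by
      rw [projR_eq_trig]
      exact (hc.rapidDecay_lineCoef hs hk).contDiff_trig 3
    refine exists_morse_perturbation (contDiff_const.mul hF) (fun θ => ?_) _ (by positivity)
      (by positivity)
    simp only [projR_eq_trig, trig_periodic (lineCoef c k) θ]
  choose! w hwM hw1 hw2 hwlow using hpert
  have hexp (k : Fin n → ℤ) :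
      Real.exp (-(s * (2 * norm1 k))) ≤ Real.exp (-(s * norm1 k)) := by
    gcongr
    have : (0 : ℝ) ≤ norm1 k := Nat.cast_nonneg _
    linarith
  have hgen := norm_genCoef_mul_exp_le (s := s) (w := w) (b := 3 * η) (by positivity)
    (fun k hk => (norm_mul_exp_le_iff _ _ _).2 ((hw1 k hk).trans (by
      linarith [mul_le_mul_of_nonneg_left (hexp k) hη0.le])))
    (fun k hk => (norm_mul_exp_le_iff _ _ _).2 ((hw2 k hk).trans (by
      gcongr
      linarith)))
  have hgenk {k : Fin n → ℤ} (hk : k ∈ gen n) : genCoef w k = quadCoef (w k) 1 := by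
    simpa using genCoef_zsmul w hk 1
  set c' : (Fin n → ℤ) → ℂ := fun m => ((1 - 3 * η : ℝ) : ℂ) * c m + genCoef w m with hc'
  have hscale (z : ℂ) : ‖((1 - 3 * η : ℝ) : ℂ) * z‖ = (1 - 3 * η) * ‖z‖ := by
    rw [norm_mul, norm_real, Real.norm_of_nonneg (by linarith)]
  have hball : InBall n s c' := by
    refine ⟨?_, fun k => ?_, fun k => ?_⟩
    · simp [hc', hc.zero, genCoef]
    · simp only [hc', hc.real, genCoef_neg, map_add, map_mul, conj_ofReal]
    · have h1 := mul_le_mul_of_nonneg_left (hc.bound k) (show 0 ≤ 1 - 3 * η by linarith)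
      have h2 := mul_le_mul_of_nonneg_right
        (norm_add_le (((1 - 3 * η : ℝ) : ℂ) * c k) (genCoef w k)) (Real.exp_pos (s * norm1 k)).le
      rw [hscale] at h2
      linarith [hgen k]
  refine ⟨c', ⟨hball, ⟨η, hη0, fun k hk => ?_⟩, fun k hk => ?_⟩, ?_⟩
  · have h1 := hwlow k hk
    have h2 := mul_le_mul_of_nonneg_left (hexp k) hη0.le
    simp only [hc', hgenk hk]
    rw [← div_le_iff₀ (Real.exp_pos _), div_eq_mul_inv, ← Real.exp_neg]
    linarith
  · convert hwM k hk using 1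
    funext θ
    have hline : lineCoef c' k =
        fun j => ((1 - 3 * η : ℝ) : ℂ) * lineCoef c k j + quadCoef (w k) j := by
      funext j
      simp only [lineCoef, hc', genCoef_zsmul w hk]
      split_ifs with hj
      · simp [hj, quadCoef_zero]
      · rfl
    rw [projR_eq_trig, projR_eq_trig, hline, ← trig_quadCoef, ← trig_const_mul]
    exact ((hc.rapidDecay_lineCoef hs hk).const_mul _).trig_add (rapidDecay_quadCoef _) θ
  · refine lt_of_le_of_lt (ciSup_le fun k => ?_) (show 6 * η < ε by linarith)
    have h1 := hc.bound k
    have h2 : c k - c' k = ((3 * η : ℝ) : ℂ) * c k - genCoef w k := by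
      simp only [hc']
      push_cast
      ring
    have h3 := mul_le_mul_of_nonneg_right
      (norm_sub_le (((3 * η : ℝ) : ℂ) * c k) (genCoef w k)) (Real.exp_pos (s * norm1 k)).le
    rw [norm_mul, norm_real, Real.norm_of_nonneg (by positivity)] at h3
    have h4 := mul_le_mul_of_nonneg_left h1 (show 0 ≤ 3 * η by positivity)
    rw [h2]
    linarith [hgen k]

end Ball

/-- `𝔾ⁿₛ` contains an open and dense subset of the unit ball `𝔹ⁿₛ`
(with respect to the norm `‖·‖ₛ`). -/
theorem stmt_4 (n : ℕ) (hn : 1 ≤ n) (s : ℝ) (hs : 0 < s) :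
    ∃ U : Set ((Fin n → ℤ) → ℂ),
      U ⊆ {c | InBall n s c} ∧ U ⊆ Gset n s ∧
      (∀ c ∈ U, ∃ ε > (0:ℝ), ∀ c', InBall n s c' → distS s c c' < ε → c' ∈ U) ∧
      (∀ c, InBall n s c → ∀ ε > (0:ℝ), ∃ c' ∈ U, distS s c c' < ε) := by
  refine ⟨uniformGset n s, fun c hc => hc.1, uniformGset_subset_Gset n s,
    fun c hc => exists_ball_subset_uniformGset hs hc, fun c hc ε hε =>
      exists_mem_uniformGset_distS_lt hs hc hε⟩

end
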